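/- Let (X,d) be a compact metric space, f : X → X a continuous map, and n ≥ 1. Suppose there exists a point x ∈ X which is non-periodic (its forward orbit {f^k(x) : k ≥ 0} is infinite), shadowable, uniformly positively n-expansive, nonwandering, and not an isolated point of X. Then there exist an integer m ≥ 1 and a nonempty closed subset Y ⊆ X with f^m(Y) ⊆ Y such that (Y, f^m|_Y) is topologically semi-conjugate to the full shift (Σ, σ). In particular, the topological entropy of f is positive. -/

import Mathlib

open Filter Topology Set
open scoped ENNReal

variable {X : Type*}

/-- A sequence `(x i)` is a `δ`-pseudo-orbit for `f` if `dist (f (x i)) (x (i+1)) < δ`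
for every `i ≥ 0`. -/
def IsPseudoOrbit [MetricSpace X] (f : X → X) (δ : ℝ) (x : ℕ → X) : Prop :=
  ∀ i : ℕ, dist (f (x i)) (x (i + 1)) < δ

/-- A sequence `(x i)` is `ε`-shadowed by the point `y`. -/
def IsShadowedBy [MetricSpace X] (f : X → X) (ε : ℝ) (x : ℕ → X) (y : X) : Prop :=
  ∀ i : ℕ, dist (f^[i] y) (x i) < ε

/-- A point `x₀` is shadowable: for every `ε > 0` there is `δ > 0` such that every
`δ`-pseudo-orbit starting at `x₀` is `ε`-shadowed by some point. -/
def ShadowablePoint [MetricSpace X] (f : X → X) (x₀ : X) : Prop :=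
  ∀ ε > (0 : ℝ), ∃ δ > (0 : ℝ), ∀ x : ℕ → X, IsPseudoOrbit f δ x → x 0 = x₀ →
    ∃ y : X, IsShadowedBy f ε x y

/-- `f` has the shadowing property. -/
def ShadowingProperty [MetricSpace X] (f : X → X) : Prop :=
  ∀ ε > (0 : ℝ), ∃ δ > (0 : ℝ), ∀ x : ℕ → X, IsPseudoOrbit f δ x →
    ∃ y : X, IsShadowedBy f ε x y

/-- A sequence of maps `F n` has the uniform shadowing property: each `F n` has the shadowing
property and, for every `ε > 0`, one single `δ > 0` works for all the maps `F n`. -/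
def UniformShadowing [MetricSpace X] (F : ℕ → X → X) : Prop :=
  (∀ n, ShadowingProperty (F n)) ∧
    ∀ ε > (0 : ℝ), ∃ δ > (0 : ℝ), ∀ n, ∀ x : ℕ → X, IsPseudoOrbit (F n) δ x →
      ∃ y : X, IsShadowedBy (F n) ε x y

/-- A point `x` is nonwandering for `f` if every neighborhood `U` of `x` satisfies
`f^n(U) ∩ U ≠ ∅` for some `n ≥ 1`. -/
def NonwanderingPt [MetricSpace X] (f : X → X) (x : X) : Prop :=
  ∀ U ∈ 𝓝 x, ∃ n : ℕ, 1 ≤ n ∧ (f^[n] '' U ∩ U).Nonempty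

/-- `s_n(V, ε)`: the maximal cardinality of an `(n, ε)`-separated subset of `V`. -/
noncomputable def sepNum [MetricSpace X] (f : X → X) (V : Set X) (n : ℕ) (ε : ℝ) : ℕ :=
  sSup {k : ℕ | ∃ E : Finset X, ↑E ⊆ V ∧ E.card = k ∧
    ∀ x ∈ E, ∀ y ∈ E, x ≠ y → ∃ i ≤ n, ε ≤ dist (f^[i] x) (f^[i] y)}

/-- `lim_{ε → 0} limsup_{n → ∞} (1/n) log s_n(V, ε)`, as a supremum over `ε > 0`
(the inner quantity is monotone as `ε` decreases). -/
noncomputable def entropyWithin [MetricSpace X] (f : X → X) (V : Set X) : ℝ≥0∞ :=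
  ⨆ (ε : ℝ) (_ : 0 < ε),
    Filter.limsup (fun n : ℕ => ENNReal.ofReal (Real.log (sepNum f V n ε) / n)) Filter.atTop

/-- The topological entropy of `f`. -/
noncomputable def topEntropy [MetricSpace X] (f : X → X) : ℝ≥0∞ :=
  entropyWithin f Set.univ

/-- `x` is a uniformly positively `n`-expansive point: there are a neighborhood `U` of `x` and
`e > 0` such that for every `y ∈ U` the set of points of `U` whose orbit stays `e`-close
to that of `y` has at most `n` elements. -/
def UnifPosNExpansivePt [MetricSpace X] (f : X → X) (n : ℕ) (x : X) : Prop :=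
  ∃ U ∈ 𝓝 x, ∃ e > (0 : ℝ), ∀ y ∈ U,
    {z ∈ U | ∀ i : ℕ, dist (f^[i] y) (f^[i] z) < e}.encard ≤ n

/-- Near a shadowable point `x`, prescribed orbit segments of common length `k` that start and
end close to `x` can be concatenated and traced by a true orbit. -/
theorem ShadowablePoint.exists_trace [MetricSpace X] {f : X → X} (hf : Continuous f) {x : X}
    (hshad : ShadowablePoint f x) {ε : ℝ} (hε : 0 < ε) :
    ∃ η > (0 : ℝ), ∀ k : ℕ, 1 ≤ k → ∀ c : ℕ → X,
      (∀ j, dist (c j) x < η) → (∀ j, dist (f^[k] (c j)) x < η) →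
      ∃ y : X, ∀ j, ∀ r < k, dist (f^[j * k + r] y) (f^[r] (c j)) < ε := by
  obtain ⟨δ, hδ, hsh⟩ := hshad (ε / 2) (half_pos hε)
  obtain ⟨η₀, hη₀, hcont⟩ := Metric.continuous_iff.1 hf x (δ / 2) (half_pos hδ)
  refine ⟨min η₀ (min (δ / 2) (ε / 2)), by positivity, fun k hk c hc hc' => ?_⟩
  simp only [lt_min_iff] at hc hc'
  obtain ⟨y, hy⟩ := hsh (fun i => if i % k = 0 then x else f^[i % k] (c (i / k)))
    (fun i => by
      have h₁ : dist (f (if i % k = 0 then x else f^[i % k] (c (i / k))))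
          (f^[i % k + 1] (c (i / k))) < δ / 2 := by
        split_ifs with h
        · rw [h, dist_comm]
          exact hcont _ (hc _).1
        · rw [Function.iterate_succ_apply', dist_self]
          exact half_pos hδ
      have h₂ : dist (f^[i % k + 1] (c (i / k)))
          (if (i + 1) % k = 0 then x else f^[(i + 1) % k] (c ((i + 1) / k))) < δ / 2 := by
        have hlt : i % k < k := Nat.mod_lt _ hk
        rcases Nat.lt_or_ge (i % k + 1) k with h | h
        · have hmod : (i + 1) % k = i % k + 1 := by
            rw [← Nat.mod_add_mod, Nat.mod_eq_of_lt h]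
          have hdiv : (i + 1) / k = i / k := by
            rw [Nat.succ_div_of_mod_ne_zero (by omega)]
          rw [if_neg (by omega), hmod, hdiv, dist_self]
          exact half_pos hδ
        · have hk' : i % k + 1 = k := by omega
          have hmod : (i + 1) % k = 0 := by
            rw [← Nat.mod_add_mod, hk', Nat.mod_self]
          rw [if_pos hmod, hk']
          exact (hc' _).2.1
      calc _ ≤ _ := dist_triangle _ (f^[i % k + 1] (c (i / k))) _
        _ < δ / 2 + δ / 2 := add_lt_add h₁ h₂
        _ = δ := add_halves δ) (by simp)
  refine ⟨y, fun j r hr => ?_⟩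
  have h := hy (j * k + r)
  have hmod : (j * k + r) % k = r := by
    rw [Nat.mul_add_mod_self_right, Nat.mod_eq_of_lt hr]
  have hdiv : (j * k + r) / k = j := by
    rw [mul_comm, Nat.mul_add_div hk, Nat.div_eq_of_lt hr, add_zero]
  simp only [hmod, hdiv] at h
  split_ifs at h with h0
  · subst h0
    calc _ ≤ _ := dist_triangle _ x _
      _ < ε / 2 + ε / 2 := add_lt_add h (by simpa [dist_comm] using (hc j).2.2)
      _ = ε := add_halves ε
  · linarith

/-- A nonwandering, shadowable, uniformly positively `n`-expansive point is approximated by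
periodic points. -/
theorem exists_periodicPt_near [MetricSpace X] {f : X → X} (hf : Continuous f) {n : ℕ} {x : X}
    (hshad : ShadowablePoint f x) (hexp : UnifPosNExpansivePt f n x) (hnw : NonwanderingPt f x)
    {ε : ℝ} (hε : 0 < ε) :
    ∃ p ∈ Metric.ball x ε, p ∈ Function.periodicPts f := by
  obtain ⟨U, hU, e, he, hfin⟩ := hexp
  obtain ⟨ρ, hρ, hball⟩ := Metric.mem_nhds_iff.1 hU
  have hε' : 0 < min (e / 2) (min (ρ / 2) (ε / 2)) := by positivity
  obtain ⟨η, hη, htrace⟩ := hshad.exists_trace hf hε'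
  obtain ⟨k, hk, b, ⟨a, ha, rfl⟩, hb⟩ :=
    hnw (Metric.ball x (min η (min (ρ / 2) (ε / 2)))) (Metric.ball_mem_nhds _ (by positivity))
  simp only [Metric.mem_ball, lt_min_iff] at ha hb
  obtain ⟨y, hy⟩ := htrace k hk (fun _ => a) (fun _ => ha.1) (fun _ => hb.1)
  simp only [lt_min_iff] at hy
  have hnear : ∀ j, dist (f^[j * k] y) x < min ρ ε := fun j => by
    have h := hy j 0 hk
    simp only [add_zero, Function.iterate_zero, id] at h
    have := dist_triangle (f^[j * k] y) a x
    exact lt_min (by linarith [h.2.1, ha.2.1]) (by linarith [h.2.2, ha.2.2])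
  simp only [lt_min_iff] at hnear
  have hclose : ∀ j i, dist (f^[i] (f^[0 * k] y)) (f^[i] (f^[j * k] y)) < e := fun j i => by
    have hi : i = (i / k) * k + i % k := by rw [mul_comm, Nat.div_add_mod]
    have key : ∀ l, dist (f^[i] (f^[l * k] y)) (f^[i % k] a) < e / 2 := fun l => by
      have h := (hy (i / k + l) (i % k) (Nat.mod_lt _ hk)).1
      rwa [show (i / k + l) * k + i % k = i + l * k by
        conv_rhs => rw [hi]
        ring, Function.iterate_add_apply] at h
    have := dist_triangle_right (f^[i] (f^[0 * k] y)) (f^[i] (f^[j * k] y)) (f^[i % k] a)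
    linarith [key 0, key j]
  have hS := Set.finite_of_encard_le_coe (hfin (f^[0 * k] y) (hball (hnear 0).1))
  have hmaps : Set.MapsTo (fun j : ℕ => f^[j * k] y) Set.univ _ := fun j _ =>
    show f^[j * k] y ∈ {z ∈ U | ∀ i : ℕ, dist (f^[i] (f^[0 * k] y)) (f^[i] z) < e} from
      ⟨hball (hnear j).1, hclose j⟩
  obtain ⟨l, -, m, -, hlm, heq⟩ := Set.infinite_univ.exists_lt_map_eq_of_mapsTo hmaps hS
  refine ⟨f^[l * k] y, (hnear l).2, (m - l) * k, Nat.mul_pos (by omega) hk, ?_⟩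
  rw [Function.IsPeriodicPt, Function.IsFixedPt, ← Function.iterate_add_apply, ← add_mul,
    Nat.sub_add_cancel hlm.le]
  exact heq.symm

/-- A point with infinite orbit is not periodic. -/
theorem notMem_periodicPts_of_infinite_orbit {f : X → X} {x : X}
    (hx : (Set.range fun k : ℕ => f^[k] x).Infinite) : x ∉ Function.periodicPts f := by
  rintro ⟨k, hk, hper⟩
  refine hx (((Set.finite_Iio k).image fun i => f^[i] x).subset ?_)
  rintro _ ⟨i, rfl⟩
  exact ⟨i % k, Nat.mod_lt _ hk, hper.iterate_mod_apply i⟩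

/-- Near a shadowable, uniformly positively `n`-expansive, nonwandering point with infinite
orbit, some iterate realises every itinerary through two
separated closed balls. -/
theorem exists_horseshoe [MetricSpace X] {f : X → X} (hf : Continuous f) {n : ℕ} {x : X}
    (hnonper : (Set.range fun k : ℕ => f^[k] x).Infinite)
    (hshad : ShadowablePoint f x) (hexp : UnifPosNExpansivePt f n x)
    (hnw : NonwanderingPt f x) :
    ∃ k ≥ 1, ∃ ε > (0 : ℝ), ∃ u : Bool → X, 3 * ε ≤ dist (u true) (u false) ∧
      ∀ s : ℕ → Bool, ∃ y : X, ∀ j, dist (f^[j * k] y) (u (s j)) ≤ ε := by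
  obtain ⟨U, hU, e, he, hfin⟩ := id hexp
  obtain ⟨ρ, hρ, hball⟩ := Metric.mem_nhds_iff.1 hU
  obtain ⟨η, hη, htrace⟩ := hshad.exists_trace hf (ε := e / 3) (by positivity)
  set T := Metric.ball x (min ρ η) ∩ Function.periodicPts f
  have hT : T.Infinite := fun hTfin => by
    have hx : Tᶜ ∈ 𝓝 x := hTfin.isClosed.isOpen_compl.mem_nhds
      fun h => notMem_periodicPts_of_infinite_orbit hnonper h.2
    obtain ⟨ε, hε, hsub⟩ := Metric.mem_nhds_iff.1 hx
    obtain ⟨p, hp, hper⟩ := exists_periodicPt_near hf hshad hexp hnw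
      (ε := min ε (min ρ η)) (by positivity)
    exact hsub (Metric.ball_subset_ball (min_le_left _ _) hp)
      ⟨Metric.ball_subset_ball (min_le_right _ _) hp, hper⟩
  obtain ⟨p, hpx, kp, hkp, hp⟩ := hT.nonempty
  have hpU := hball (Metric.ball_subset_ball (min_le_left _ _) hpx)
  obtain ⟨q, ⟨hqx, kq, hkq, hq⟩, hpq⟩ :=
    hT.exists_notMem_finite (Set.finite_of_encard_le_coe (hfin p hpU))
  have hqU := hball (Metric.ball_subset_ball (min_le_left _ _) hqx)
  obtain ⟨i, hi⟩ : ∃ i, e ≤ dist (f^[i] p) (f^[i] q) := by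
    by_contra! h
    exact hpq ⟨hqU, h⟩
  have hk : 0 < kp * kq := Nat.mul_pos hkp hkq
  have hp' : f^[kp * kq] p = p := hp.mul_const kq
  have hq' : f^[kp * kq] q = q := hq.const_mul kp
  have hpη : dist p x < η := Metric.ball_subset_ball (min_le_right _ _) hpx
  have hqη : dist q x < η := Metric.ball_subset_ball (min_le_right _ _) hqx
  refine ⟨kp * kq, hk, e / 3, by positivity,
    fun b => f^[i % (kp * kq)] (if b then p else q), ?_, fun s => ?_⟩
  · have h₁ := (hp.mul_const kq).iterate_mod_apply i
    have h₂ := (hq.const_mul kp).iterate_mod_apply i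
    simp only [if_true, Bool.false_eq_true, if_false, h₁, h₂]
    linarith
  · obtain ⟨y, hy⟩ := htrace (kp * kq) hk (fun j => if s j then p else q)
      (fun j => by split_ifs <;> assumption)
      (fun j => by split_ifs <;> simpa only [hp', hq'])
    refine ⟨f^[i % (kp * kq)] y, fun j => ?_⟩
    rw [← Function.iterate_add_apply]
    exact (hy j _ (Nat.mod_lt _ hk)).le

/-- If all itineraries through two separated closed balls are realised by `f^[k]`, then a
subsystem of `f^[k]` is semi-conjugate to the full shift. -/
theorem exists_semiconj_shift [MetricSpace X] [CompactSpace X] {f : X → X} (hf : Continuous f)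
    {k : ℕ} {ε : ℝ} (hε : 0 < ε) {u : Bool → X} (hu : 3 * ε ≤ dist (u true) (u false))
    (hall : ∀ s : ℕ → Bool, ∃ y : X, ∀ j, dist (f^[j * k] y) (u (s j)) ≤ ε) :
    ∃ Y : Set X, Y.Nonempty ∧ IsClosed Y ∧
      ∃ h : Set.MapsTo f^[k] Y Y, ∃ π : Y → (ℕ → Bool),
        Continuous π ∧ Function.Surjective π ∧
        ∀ y : Y, π ⟨f^[k] ↑y, h y.2⟩ = fun i => (π y) (i + 1) := by
  have huniq : ∀ (z : X) (b c : Bool), dist z (u b) ≤ ε → dist z (u c) ≤ ε → b = c := by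
    intro z b c hb hc
    have h₁ := dist_triangle_left (u b) (u c) z
    have h₂ := dist_comm (u true) (u false)
    cases b <;> cases c <;> first | rfl | (exfalso; linarith)
  set Z : Set (X × (ℕ → Bool)) := {w | ∀ j, dist (f^[j * k] w.1) (u (w.2 j)) ≤ ε} with hZ
  have hZc : IsClosed Z := by
    rw [hZ, Set.ofPred_forall]
    refine isClosed_iInter fun j => isClosed_le ?_ continuous_const
    exact ((hf.iterate _).comp continuous_fst).dist
      (continuous_of_discreteTopology.comp ((continuous_apply j).comp continuous_snd))
  have hYc : IsClosed (Prod.fst '' Z) := isClosedMap_fst_of_compactSpace _ hZc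
  have hY : ∀ y : Prod.fst '' Z, ∃ s, (y.1, s) ∈ Z := by
    rintro ⟨_, ⟨y, s⟩, h, rfl⟩
    exact ⟨s, h⟩
  choose π hπ using hY
  have hπ' : ∀ (y : Prod.fst '' Z) s, (y.1, s) ∈ Z → π y = s := fun y s h =>
    funext fun j => huniq _ _ _ (hπ y j) (h j)
  have hshift : ∀ (y : X) s, (y, s) ∈ Z → (f^[k] y, fun i => s (i + 1)) ∈ Z := by
    intro y s h j
    have := h (j + 1)
    rwa [add_mul, one_mul, Function.iterate_add_apply] at this
  have hmaps : Set.MapsTo f^[k] (Prod.fst '' Z) (Prod.fst '' Z) := by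
    rintro _ ⟨⟨y, s⟩, h, rfl⟩
    exact ⟨_, hshift y s h, rfl⟩
  refine ⟨Prod.fst '' Z, ?_, hYc, hmaps, π, ?_, ?_, ?_⟩
  · obtain ⟨y, hy⟩ := hall fun _ => true
    exact ⟨y, (y, fun _ => true), hy, rfl⟩
  · refine continuous_iff_isClosed.2 fun C hC => ?_
    have hpre : π ⁻¹' C = Subtype.val ⁻¹' (Prod.fst '' (Z ∩ Prod.snd ⁻¹' C)) := by
      ext y
      constructor
      · exact fun h => ⟨(y.1, π y), ⟨hπ y, h⟩, rfl⟩
      · rintro ⟨⟨z, s⟩, ⟨h, hs⟩, rfl : z = y.1⟩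
        rw [Set.mem_preimage, hπ' y s h]
        exact hs
    rw [hpre]
    exact (isClosedMap_fst_of_compactSpace _
      (hZc.inter (hC.preimage continuous_snd))).preimage continuous_subtype_val
  · intro s
    obtain ⟨y, hy⟩ := hall s
    exact ⟨⟨y, (y, s), hy, rfl⟩, hπ' _ s hy⟩
  · exact fun y => hπ' _ _ (hshift _ _ (hπ y))

/-- On a compact space the cardinalities of `(n, ε)`-separated sets are bounded, so any
separated set bounds `sepNum` from below. -/
theorem card_le_sepNum [MetricSpace X] [CompactSpace X] {f : X → X} (hf : Continuous f)
    {V : Set X} {n : ℕ} {ε : ℝ} (hε : 0 < ε) {E : Finset X} (hE : ↑E ⊆ V)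
    (hsep : ∀ x ∈ E, ∀ y ∈ E, x ≠ y → ∃ i ≤ n, ε ≤ dist (f^[i] x) (f^[i] y)) :
    E.card ≤ sepNum f V n ε := by
  have hnhds : ∀ x : X, {y | ∀ i ∈ Set.Iic n, dist (f^[i] y) (f^[i] x) < ε / 2} ∈ 𝓝 x := by
    intro x
    rw [Set.ofPred_forall]
    simp only [Set.ofPred_forall]
    refine (Filter.biInter_mem (Set.finite_Iic n)).2 fun i _ => ?_
    exact (hf.iterate i).continuousAt.preimage_mem_nhds (Metric.ball_mem_nhds _ (half_pos hε))
  obtain ⟨t, ht⟩ := CompactSpace.elim_nhds_subcover _ hnhds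
  have hcov : ∀ y : X, ∃ x ∈ t, ∀ i ≤ n, dist (f^[i] y) (f^[i] x) < ε / 2 := fun y => by
    have : y ∈ (⊤ : Set X) := trivial
    rw [← ht] at this
    simpa using this
  choose g hgt hg using hcov
  refine le_csSup ⟨t.card, ?_⟩ ⟨E, hE, rfl, hsep⟩
  rintro _ ⟨F, -, rfl, hF⟩
  refine Finset.card_le_card_of_injOn g (fun y _ => hgt y) fun y hy z hz hyz => ?_
  by_contra hne
  obtain ⟨i, hi, hd⟩ := hF y hy z hz hne
  have h₁ := hg y i hi
  have h₂ := hg z i hi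
  rw [← hyz] at h₂
  linarith [dist_triangle_right (f^[i] y) (f^[i] z) (f^[i] (g y))]

/-- If all itineraries through two separated closed balls are realised by `f^[k]`, then `f` has
positive topological entropy. -/
theorem topEntropy_pos_of_horseshoe [MetricSpace X] [CompactSpace X] {f : X → X}
    (hf : Continuous f) {k : ℕ} (hk : 1 ≤ k) {ε : ℝ} (hε : 0 < ε) {u : Bool → X}
    (hu : 3 * ε ≤ dist (u true) (u false))
    (hall : ∀ s : ℕ → Bool, ∃ y : X, ∀ j, dist (f^[j * k] y) (u (s j)) ≤ ε) :
    0 < topEntropy f := by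
  classical
  choose y hy using hall
  have hdist : ∀ b c, b ≠ c → 3 * ε ≤ dist (u b) (u c) := by
    intro b c hbc
    have h₂ := dist_comm (u true) (u false)
    cases b <;> cases c <;> first | exact absurd rfl hbc | linarith
  have hcard : ∀ N : ℕ, 2 ^ N ≤ sepNum f Set.univ (N * k) ε := by
    intro N
    let pad : (Fin N → Bool) → ℕ → Bool := fun w j => if h : j < N then w ⟨j, h⟩ else false
    have hsep : ∀ w v : Fin N → Bool, w ≠ v →
        ∃ i ≤ N * k, ε ≤ dist (f^[i] (y (pad w))) (f^[i] (y (pad v))) := by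
      intro w v hwv
      obtain ⟨j, hj⟩ := Function.ne_iff.1 hwv
      refine ⟨j * k, Nat.mul_le_mul_right _ j.2.le, ?_⟩
      have h₁ := hy (pad w) j
      have h₂ := hy (pad v) j
      simp only [pad, j.2, dif_pos, Fin.eta] at h₁ h₂
      have h₃ := hdist _ _ hj
      have h₄ := dist_triangle4 (u (w j)) (f^[j * k] (y (pad w))) (f^[j * k] (y (pad v)))
        (u (v j))
      rw [dist_comm (u (w j)) (f^[j * k] (y (pad w)))] at h₄
      linarith
    have hinj : Function.Injective fun w => y (pad w) := by
      intro w v hwv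
      by_contra hne
      obtain ⟨i, -, hi⟩ := hsep w v hne
      have : y (pad w) = y (pad v) := hwv
      rw [this, dist_self] at hi
      linarith
    have h := card_le_sepNum hf (V := Set.univ) (n := N * k) hε
      (E := Finset.univ.image fun w => y (pad w)) (Set.subset_univ _) (by
        simp only [Finset.mem_image, Finset.mem_univ, true_and]
        rintro _ ⟨w, rfl⟩ _ ⟨v, rfl⟩ hne
        exact hsep w v fun h => hne (by rw [h]))
    rwa [Finset.card_image_of_injective _ hinj, Finset.card_univ, Fintype.card_fun,
      Fintype.card_bool, Fintype.card_fin] at h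
  have hk' : (0 : ℝ) < k := by exact_mod_cast hk
  have hpos : 0 < ENNReal.ofReal (Real.log 2 / k) :=
    ENNReal.ofReal_pos.2 (div_pos (Real.log_pos one_lt_two) hk')
  refine hpos.trans_le ?_
  rw [topEntropy, entropyWithin]
  refine le_iSup₂_of_le ε hε (Filter.le_limsup_of_frequently_le ?_)
  refine Filter.frequently_atTop.2 fun a => ⟨(a + 1) * k, by nlinarith, ?_⟩
  refine ENNReal.ofReal_le_ofReal ?_
  have h : (2 : ℝ) ^ (a + 1) ≤ sepNum f Set.univ ((a + 1) * k) ε := by exact_mod_cast hcard (a + 1)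
  have hlog := Real.log_le_log (by positivity) h
  rw [Real.log_pow] at hlog
  rw [div_le_div_iff₀ hk' (by positivity)]
  push_cast at hlog ⊢
  nlinarith

/-- Theorem: if there is a non-periodic, shadowable, uniformly positively `n`-expansive,
nonwandering, non-isolated point, then some `(Y, f^m)` is semi-conjugate to the full shift
`({0,1}^ℕ, σ)`, and `f` has positive topological entropy. -/
theorem stmt1 [MetricSpace X] [CompactSpace X] (f : X → X) (hf : Continuous f)
    (n : ℕ) (hn : 1 ≤ n) (x : X)
    (hnonper : (Set.range fun k : ℕ => f^[k] x).Infinite)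
    (hshad : ShadowablePoint f x)
    (hexp : UnifPosNExpansivePt f n x)
    (hnw : NonwanderingPt f x)
    (hnotisol : (𝓝[≠] x).NeBot) :
    (∃ m : ℕ, 1 ≤ m ∧ ∃ Y : Set X, Y.Nonempty ∧ IsClosed Y ∧
      ∃ h : Set.MapsTo f^[m] Y Y, ∃ π : Y → (ℕ → Bool),
        Continuous π ∧ Function.Surjective π ∧
        ∀ y : Y, π ⟨f^[m] ↑y, h y.2⟩ = fun i => (π y) (i + 1)) ∧
      0 < topEntropy f := by
  obtain ⟨k, hk, ε, hε, u, hu, hall⟩ := exists_horseshoe hf hnonper hshad hexp hnw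
  exact ⟨⟨k, hk, exists_semiconj_shift hf hε hu hall⟩,
    topEntropy_pos_of_horseshoe hf hk hε hu hall⟩
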